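/- Strong duality for worst-case expectation over a KL ball: for a random variable G(X) with finite moment generating function in a neighborhood of zero under a distribution P₀ on a finite set, and any δ > 0, sup over distributions P with D_KL(P‖P₀) ≤ δ of E_P[G(X)] equals inf_{β≥0} { β log(E_{P₀}[exp(G(X)/β)]) + βδ }, where at β = 0 the expression is interpreted as esssup_{P₀} G(X). -/

import Mathlib

open Real

/-- Gibbs variational inequality on a finite set. -/
theorem sum_mul_le_log_sum_exp_add_kl {Ω : Type*} [Fintype Ω] {P0 P : Ω → ℝ}
    (hP0 : ∀ x, 0 ≤ P0 x) (hP : ∀ x, 0 ≤ P x) (hP1 : ∑ x, P x = 1)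
    (hac : ∀ x, P0 x = 0 → P x = 0) (h : Ω → ℝ)
    (hZ : 0 < ∑ x, P0 x * exp (h x)) :
    ∑ x, P x * h x ≤ log (∑ x, P0 x * exp (h x)) + ∑ x, P x * log (P x / P0 x) := by
  set Z := ∑ x, P0 x * exp (h x) with hZdef
  have key : ∀ x, P x * h x - P x * log (P x / P0 x) - P x * log Z
      ≤ P0 x * exp (h x) / Z - P x := by
    intro x
    rcases (hP x).eq_or_lt with hx | hx
    · rw [← hx]
      have := hP0 x
      simp only [zero_mul, sub_zero]
      positivity
    · have h0 : 0 < P0 x := (hP0 x).lt_of_ne fun h0 => hx.ne' (hac x h0.symm)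
      have hlog := log_le_sub_one_of_pos
        (show 0 < P0 x * exp (h x) / (Z * P x) by positivity)
      rw [log_div (by positivity) (by positivity), log_mul h0.ne' (exp_pos _).ne',
        log_exp, log_mul hZ.ne' hx.ne'] at hlog
      rw [log_div hx.ne' h0.ne']
      have hmul := mul_le_mul_of_nonneg_left hlog hx.le
      have : P x * (P0 x * exp (h x) / (Z * P x) - 1) = P0 x * exp (h x) / Z - P x := by
        field_simp
      linarith
  have hsum := Finset.sum_le_sum fun x (_ : x ∈ Finset.univ) => key x
  simp only [Finset.sum_sub_distrib, ← Finset.sum_mul, ← Finset.sum_div, hP1] at hsum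
  rw [← hZdef, div_self hZ.ne'] at hsum
  linarith

theorem sum_mul_exp_pos {Ω : Type*} [Fintype Ω] {P0 : Ω → ℝ}
    (hP0 : ∀ x, 0 ≤ P0 x) (hP01 : ∑ x, P0 x = 1) (h : Ω → ℝ) :
    0 < ∑ x, P0 x * exp (h x) := by
  obtain ⟨x, -, hx⟩ := Finset.exists_ne_zero_of_sum_ne_zero
    (show ∑ x, P0 x ≠ 0 by rw [hP01]; exact one_ne_zero)
  exact Finset.sum_pos' (fun y _ => mul_nonneg (hP0 y) (exp_pos _).le)
    ⟨x, Finset.mem_univ x, mul_pos ((hP0 x).lt_of_ne hx.symm) (exp_pos _)⟩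

/-- The exponential tilting of `P0` by `t * G`. -/
noncomputable def expTilt {Ω : Type*} [Fintype Ω] (P0 G : Ω → ℝ) (t : ℝ) (x : Ω) : ℝ :=
  P0 x * exp (t * G x) / ∑ y, P0 y * exp (t * G y)

section expTilt

variable {Ω : Type*} [Fintype Ω] {P0 : Ω → ℝ}

theorem expTilt_nonneg (hP0 : ∀ x, 0 ≤ P0 x) (hP01 : ∑ x, P0 x = 1) (G : Ω → ℝ) (t : ℝ)
    (x : Ω) : 0 ≤ expTilt P0 G t x :=
  div_nonneg (mul_nonneg (hP0 x) (exp_pos _).le) (sum_mul_exp_pos hP0 hP01 _).le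

theorem sum_expTilt (hP0 : ∀ x, 0 ≤ P0 x) (hP01 : ∑ x, P0 x = 1) (G : Ω → ℝ) (t : ℝ) :
    ∑ x, expTilt P0 G t x = 1 := by
  simp only [expTilt, ← Finset.sum_div]
  exact div_self (sum_mul_exp_pos hP0 hP01 _).ne'

theorem expTilt_eq_zero (G : Ω → ℝ) (t : ℝ) (x : Ω) (hx : P0 x = 0) :
    expTilt P0 G t x = 0 := by
  simp [expTilt, hx]

theorem kl_expTilt (hP0 : ∀ x, 0 ≤ P0 x) (hP01 : ∑ x, P0 x = 1) (G : Ω → ℝ) (t : ℝ) :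
    ∑ x, expTilt P0 G t x * log (expTilt P0 G t x / P0 x)
      = t * ∑ x, expTilt P0 G t x * G x - log (∑ x, P0 x * exp (t * G x)) := by
  have hZ := sum_mul_exp_pos hP0 hP01 fun x => t * G x
  have hterm : ∀ x, expTilt P0 G t x * log (expTilt P0 G t x / P0 x)
      = t * (expTilt P0 G t x * G x)
        - expTilt P0 G t x * log (∑ x, P0 x * exp (t * G x)) := by
    intro x
    rcases eq_or_ne (P0 x) 0 with hx | hx
    · simp [expTilt_eq_zero G t x hx]
    · have hratio : expTilt P0 G t x / P0 x
          = exp (t * G x) / ∑ y, P0 y * exp (t * G y) := by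
        rw [expTilt]; field_simp
      rw [hratio, log_div (exp_pos _).ne' hZ.ne', log_exp]
      ring
  rw [Finset.sum_congr rfl fun x _ => hterm x, Finset.sum_sub_distrib, ← Finset.mul_sum,
    ← Finset.sum_mul, sum_expTilt hP0 hP01, one_mul]

theorem continuous_kl_expTilt (hP0 : ∀ x, 0 ≤ P0 x) (hP01 : ∑ x, P0 x = 1) (G : Ω → ℝ) :
    Continuous fun t => ∑ x, expTilt P0 G t x * log (expTilt P0 G t x / P0 x) := by
  have hZ : ∀ t : ℝ, ∑ x, P0 x * exp (t * G x) ≠ 0 := fun t =>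
    (sum_mul_exp_pos hP0 hP01 fun x => t * G x).ne'
  have hZc : Continuous fun t : ℝ => ∑ x, P0 x * exp (t * G x) := by fun_prop
  have hT : ∀ x, Continuous fun t => expTilt P0 G t x := fun x =>
    Continuous.div (by fun_prop) hZc hZ
  simp only [kl_expTilt hP0 hP01]
  exact (continuous_id.mul (continuous_finsetSum _ fun x _ => (hT x).mul continuous_const)).sub
    (hZc.log hZ)

theorem kl_expTilt_zero (hP0 : ∀ x, 0 ≤ P0 x) (hP01 : ∑ x, P0 x = 1) (G : Ω → ℝ) :
    ∑ x, expTilt P0 G 0 x * log (expTilt P0 G 0 x / P0 x) = 0 := by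
  rw [kl_expTilt hP0 hP01]
  simp [hP01]

theorem le_sum_expTilt_mul (hP0 : ∀ x, 0 ≤ P0 x) (hP01 : ∑ x, P0 x = 1) (G : Ω → ℝ)
    {t : ℝ} (ht : 0 < t) {x : Ω} (hx : 0 < P0 x) :
    G x + log (P0 x) / t ≤ ∑ x, expTilt P0 G t x * G x := by
  have hnn := sum_mul_le_log_sum_exp_add_kl hP0 (expTilt_nonneg hP0 hP01 G t)
    (sum_expTilt hP0 hP01 G t) (expTilt_eq_zero G t) 0 (by simp [hP01])
  simp only [Pi.zero_apply, mul_zero, Finset.sum_const_zero, exp_zero, mul_one, hP01, log_one,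
    zero_add, kl_expTilt hP0 hP01] at hnn
  have hle : P0 x * exp (t * G x) ≤ ∑ y, P0 y * exp (t * G y) :=
    Finset.single_le_sum (f := fun y => P0 y * exp (t * G y))
      (fun y _ => mul_nonneg (hP0 y) (exp_pos _).le) (Finset.mem_univ x)
  have hlog := log_le_log (by positivity) hle
  rw [log_mul hx.ne' (exp_pos _).ne', log_exp] at hlog
  refine le_of_mul_le_mul_left ?_ ht
  have : t * (G x + log (P0 x) / t) = t * G x + log (P0 x) := by field_simp
  linarith

end expTilt

/-- Strong duality for the worst-case expectation over a KL ball on a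
finite set: the sup of `E_P[G]` over distributions `P ≪ P₀` with `D_KL(P‖P₀) ≤ δ`
equals the dual infimum over `β ≥ 0`, interpreted at `β = 0` as `esssup_{P₀} G`. -/
theorem stmt4 {Ω : Type*} [Fintype Ω] [Nonempty Ω]
    (P0 : Ω → ℝ) (hP0 : ∀ x, 0 ≤ P0 x) (hP01 : ∑ x, P0 x = 1)
    (G : Ω → ℝ) (δ : ℝ) (hδ : 0 < δ)
    (dual : ℝ → ℝ)
    (hdual0 : dual 0 = sSup {y | ∃ x, 0 < P0 x ∧ y = G x})
    (hdualpos : ∀ β > (0 : ℝ),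
      dual β = β * Real.log (∑ x, P0 x * Real.exp (G x / β)) + β * δ) :
    sSup {y | ∃ P : Ω → ℝ, (∀ x, 0 ≤ P x) ∧ (∑ x, P x = 1) ∧
        (∀ x, P0 x = 0 → P x = 0) ∧
        (∑ x, P x * Real.log (P x / P0 x)) ≤ δ ∧
        y = ∑ x, P x * G x}
      = sInf {y | ∃ β : ℝ, 0 ≤ β ∧ y = dual β} := by
  set S := {y | ∃ P : Ω → ℝ, (∀ x, 0 ≤ P x) ∧ (∑ x, P x = 1) ∧
        (∀ x, P0 x = 0 → P x = 0) ∧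
        (∑ x, P x * Real.log (P x / P0 x)) ≤ δ ∧
        y = ∑ x, P x * G x}
  set E := {y | ∃ x, 0 < P0 x ∧ y = G x}
  have hEfin : E.Finite := (Set.finite_range G).subset (by rintro y ⟨x, -, rfl⟩; exact ⟨x, rfl⟩)
  have hEne : E.Nonempty := by
    obtain ⟨x, -, hx⟩ := Finset.exists_ne_zero_of_sum_ne_zero
      (show ∑ x, P0 x ≠ 0 by rw [hP01]; exact one_ne_zero)
    exact ⟨G x, x, (hP0 x).lt_of_ne hx.symm, rfl⟩
  have hweak : ∀ y ∈ S, ∀ β, 0 ≤ β → y ≤ dual β := by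
    rintro y ⟨P, hP, hP1, hac, hKL, rfl⟩ β hβ
    rcases hβ.eq_or_lt with rfl | hβ
    · rw [hdual0]
      calc ∑ x, P x * G x ≤ ∑ x, P x * sSup E := by
            refine Finset.sum_le_sum fun x _ => ?_
            rcases (hP0 x).eq_or_lt with h0 | h0
            · simp [hac x h0.symm]
            · exact mul_le_mul_of_nonneg_left (le_csSup hEfin.bddAbove ⟨x, h0, rfl⟩) (hP x)
        _ = sSup E := by rw [← Finset.sum_mul, hP1, one_mul]
    · rw [hdualpos β hβ, ← mul_add]
      have hG := sum_mul_le_log_sum_exp_add_kl hP0 hP hP1 hac (fun x => G x / β)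
        (sum_mul_exp_pos hP0 hP01 _)
      calc ∑ x, P x * G x = β * ∑ x, P x * (G x / β) := by
            rw [Finset.mul_sum]
            exact Finset.sum_congr rfl fun x _ => by field_simp
        _ ≤ _ := mul_le_mul_of_nonneg_left (by linarith) hβ.le
  have htilt : ∀ t, ∑ x, expTilt P0 G t x * log (expTilt P0 G t x / P0 x) ≤ δ →
      ∑ x, expTilt P0 G t x * G x ∈ S := fun t ht =>
    ⟨expTilt P0 G t, expTilt_nonneg hP0 hP01 G t, sum_expTilt hP0 hP01 G t,
      expTilt_eq_zero G t, ht, rfl⟩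
  have hSne : S.Nonempty := ⟨_, htilt 0 (by rw [kl_expTilt_zero hP0 hP01]; exact hδ.le)⟩
  have hSbdd : BddAbove S := ⟨dual 0, fun y hy => hweak y hy 0 le_rfl⟩
  have hDbdd : BddBelow {y | ∃ β : ℝ, 0 ≤ β ∧ y = dual β} := by
    obtain ⟨y, hy⟩ := hSne
    exact ⟨y, by rintro _ ⟨β, hβ, rfl⟩; exact hweak y hy β hβ⟩
  apply le_antisymm
  · refine csSup_le hSne fun y hy => le_csInf ⟨dual 0, 0, le_rfl, rfl⟩ ?_
    rintro _ ⟨β, hβ, rfl⟩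
    exact hweak y hy β hβ
  by_cases hex : ∃ t, 0 < t ∧ δ ≤ ∑ x, expTilt P0 G t x * log (expTilt P0 G t x / P0 x)
  · obtain ⟨T, hT, hTδ⟩ := hex
    obtain ⟨t, ⟨ht0, -⟩, ht⟩ := intermediate_value_Icc hT.le
      (continuous_kl_expTilt hP0 hP01 G).continuousOn
      ⟨(kl_expTilt_zero hP0 hP01 G).le.trans hδ.le, hTδ⟩
    dsimp only at ht
    have htpos : 0 < t := ht0.lt_of_ne <| by
      rintro rfl
      rw [kl_expTilt_zero hP0 hP01] at ht
      exact hδ.ne ht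
    refine (csInf_le hDbdd ⟨t⁻¹, (inv_pos.2 htpos).le, rfl⟩).trans
      (le_trans (le_of_eq ?_) (le_csSup hSbdd (htilt t ht.le)))
    rw [hdualpos _ (inv_pos.2 htpos), ← ht, kl_expTilt hP0 hP01]
    simp only [div_inv_eq_mul, mul_comm (G _) t]
    field_simp
    ring
  · push Not at hex
    obtain ⟨x, hx, hxE⟩ := hEne.csSup_mem hEfin
    refine (csInf_le hDbdd ⟨0, le_rfl, rfl⟩).trans ?_
    rw [hdual0, hxE]
    have hlim : Filter.Tendsto (fun t : ℝ => G x + log (P0 x) / t) Filter.atTop (nhds (G x)) := by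
      simpa using (tendsto_const_nhds (x := G x)).add
        ((tendsto_const_nhds (x := log (P0 x))).div_atTop Filter.tendsto_id)
    refine le_of_tendsto hlim ?_
    filter_upwards [Filter.eventually_gt_atTop 0] with t ht
    exact (le_sum_expTilt_mul hP0 hP01 G ht hx).trans (le_csSup hSbdd (htilt t (hex t ht).le))
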